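/- arXiv:1301.0927 — 2 statements merged into one kernel-verified Lean document; each statement's English description precedes it below -/
import Mathlib

section
/- There exists a constant C > 0 such that for all t ∈ (0,1]: |t · φ'(t)| ≤ C, |t² · φ''(t)| ≤ C, and |t³ · φ'''(t)| ≤ C, where φ', φ'', φ''' denote the first, second and third derivatives of φ (deriv φ, deriv^[2] φ, deriv^[3] φ). -/
/-- `φ(t) = log (log (e − log t))`. -/
noncomputable def φ (t : ℝ) : ℝ := Real.log (Real.log (Real.exp 1 - Real.log t))

/-- The reciprocal of the inner function `e − log t` of `φ`. -/
noncomputable def invInner (t : ℝ) : ℝ := (Real.exp 1 - Real.log t)⁻¹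

/-- The reciprocal of `log (e − log t)`. -/
noncomputable def invLogInner (t : ℝ) : ℝ := (Real.log (Real.exp 1 - Real.log t))⁻¹

theorem one_lt_exp_one_sub_log {t : ℝ} (ht : t ∈ Set.Ioo 0 (Real.exp 1)) :
    1 < Real.exp 1 - Real.log t := by
  have h1 : Real.log t < 1 := (Real.log_lt_iff_lt_exp ht.1).2 ht.2
  have h2 := Real.add_one_lt_exp one_ne_zero
  linarith

theorem hasDerivAt_exp_one_sub_log {t : ℝ} (ht : t ≠ 0) :
    HasDerivAt (fun s ↦ Real.exp 1 - Real.log s) (-t⁻¹) t :=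
  (Real.hasDerivAt_log ht).const_sub _

theorem hasDerivAt_log_exp_one_sub_log {t : ℝ} (ht : t ∈ Set.Ioo 0 (Real.exp 1)) :
    HasDerivAt (fun s ↦ Real.log (Real.exp 1 - Real.log s)) (-t⁻¹ * invInner t) t := by
  have hu := one_lt_exp_one_sub_log ht
  exact (hasDerivAt_exp_one_sub_log ht.1.ne').log (by linarith)

theorem hasDerivAt_invInner {t : ℝ} (ht : t ∈ Set.Ioo 0 (Real.exp 1)) :
    HasDerivAt invInner (t⁻¹ * invInner t ^ 2) t := by
  have hu := one_lt_exp_one_sub_log ht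
  have h : HasDerivAt invInner _ t := (hasDerivAt_exp_one_sub_log ht.1.ne').fun_inv (by linarith)
  refine h.congr_deriv ?_
  rw [invInner, neg_neg, div_eq_mul_inv, inv_pow]

theorem hasDerivAt_invLogInner {t : ℝ} (ht : t ∈ Set.Ioo 0 (Real.exp 1)) :
    HasDerivAt invLogInner (t⁻¹ * (invInner t * invLogInner t ^ 2)) t := by
  have hL := Real.log_pos (one_lt_exp_one_sub_log ht)
  have h : HasDerivAt invLogInner _ t := (hasDerivAt_log_exp_one_sub_log ht).fun_inv hL.ne'
  refine h.congr_deriv ?_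
  simp only [invLogInner]
  ring

theorem deriv_φ {t : ℝ} (ht : t ∈ Set.Ioo 0 (Real.exp 1)) :
    deriv φ t = -(t⁻¹ * (invInner t * invLogInner t)) := by
  have hL := Real.log_pos (one_lt_exp_one_sub_log ht)
  have h : HasDerivAt φ _ t := (hasDerivAt_log_exp_one_sub_log ht).log hL.ne'
  rw [h.deriv]
  simp only [invLogInner]
  ring

theorem deriv_deriv_φ {t : ℝ} (ht : t ∈ Set.Ioo 0 (Real.exp 1)) :
    deriv (deriv φ) t = t⁻¹ ^ 2 * (invInner t * invLogInner t
      - invInner t ^ 2 * invLogInner t - invInner t ^ 2 * invLogInner t ^ 2) := by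
  have heq : deriv φ =ᶠ[nhds t] fun s ↦ -(s⁻¹ * (invInner s * invLogInner s)) := by
    filter_upwards [isOpen_Ioo.mem_nhds ht] with s hs using deriv_φ hs
  have ha := hasDerivAt_invInner ht
  have hb := hasDerivAt_invLogInner ht
  rw [heq.deriv_eq, ((hasDerivAt_inv ht.1.ne').fun_mul (ha.fun_mul hb)).fun_neg.deriv]
  ring

theorem deriv_deriv_deriv_φ {t : ℝ} (ht : t ∈ Set.Ioo 0 (Real.exp 1)) :
    deriv (deriv (deriv φ)) t = t⁻¹ ^ 3 *
      (-2 * (invInner t * invLogInner t)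
        + 3 * (invInner t ^ 2 * invLogInner t) + 3 * (invInner t ^ 2 * invLogInner t ^ 2)
        - 2 * (invInner t ^ 3 * invLogInner t) - 3 * (invInner t ^ 3 * invLogInner t ^ 2)
        - 2 * (invInner t ^ 3 * invLogInner t ^ 3)) := by
  have heq : deriv (deriv φ) =ᶠ[nhds t] fun s ↦ s⁻¹ ^ 2 * (invInner s * invLogInner s
      - invInner s ^ 2 * invLogInner s - invInner s ^ 2 * invLogInner s ^ 2) := by
    filter_upwards [isOpen_Ioo.mem_nhds ht] with s hs using deriv_deriv_φ hs
  have ha := hasDerivAt_invInner ht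
  have hb := hasDerivAt_invLogInner ht
  rw [heq.deriv_eq, (((hasDerivAt_inv ht.1.ne').fun_pow 2).fun_mul
    (((ha.fun_mul hb).fun_sub ((ha.fun_pow 2).fun_mul hb)).fun_sub
      ((ha.fun_pow 2).fun_mul (hb.fun_pow 2)))).deriv]
  push_cast
  ring

theorem pow_mul_pow_mem_Icc {a b : ℝ} (ha : a ∈ Set.Icc (0 : ℝ) 1) (hb : b ∈ Set.Icc (0 : ℝ) 1)
    (m n : ℕ) : a ^ m * b ^ n ∈ Set.Icc (0 : ℝ) 1 :=
  ⟨mul_nonneg (pow_nonneg ha.1 m) (pow_nonneg hb.1 n),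
    mul_le_one₀ (pow_le_one₀ ha.1 ha.2) (pow_nonneg hb.1 n) (pow_le_one₀ hb.1 hb.2)⟩

/-- Lemma 4.2: the functions `t φ'(t)`, `t² φ''(t)` and `t³ φ'''(t)` are bounded on `(0,1]`. -/
theorem stmt_3 :
    ∃ C > 0, ∀ t ∈ Set.Ioc (0 : ℝ) 1,
      |t * deriv φ t| ≤ C ∧
      |t ^ 2 * deriv^[2] φ t| ≤ C ∧
      |t ^ 3 * deriv^[3] φ t| ≤ C := by
  refine ⟨9, by norm_num, fun t ht ↦ ?_⟩
  have hte : t ∈ Set.Ioo 0 (Real.exp 1) :=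
    ⟨ht.1, ht.2.trans_lt (Real.one_lt_exp_iff.2 one_pos)⟩
  have hu : Real.exp 1 ≤ Real.exp 1 - Real.log t := by
    linarith [Real.log_nonpos ht.1.le ht.2]
  have hL : 1 ≤ Real.log (Real.exp 1 - Real.log t) :=
    (Real.le_log_iff_exp_le ((Real.exp_pos 1).trans_le hu)).2 hu
  have hu' := (one_lt_exp_one_sub_log hte).le
  have ha : invInner t ∈ Set.Icc (0 : ℝ) 1 :=
    ⟨inv_nonneg.2 (zero_le_one.trans hu'), inv_le_one_of_one_le₀ hu'⟩
  have hb : invLogInner t ∈ Set.Icc (0 : ℝ) 1 :=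
    ⟨inv_nonneg.2 (zero_le_one.trans hL), inv_le_one_of_one_le₀ hL⟩
  have hmem := pow_mul_pow_mem_Icc ha hb
  have h11 := hmem 1 1
  have h21 := hmem 2 1
  have h22 := hmem 2 2
  have h31 := hmem 3 1
  have h32 := hmem 3 2
  have h33 := hmem 3 3
  simp only [pow_one, Set.mem_Icc] at h11 h21 h22 h31 h32 h33
  have ht0 : t * t⁻¹ = 1 := mul_inv_cancel₀ ht.1.ne'
  simp only [Function.iterate_succ, Function.iterate_zero, Function.comp_apply, id_eq]
  rw [deriv_φ hte, deriv_deriv_φ hte, deriv_deriv_deriv_φ hte, mul_neg, ← mul_assoc,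
    ← mul_assoc (t ^ 2), ← mul_assoc (t ^ 3), ← mul_pow t, ← mul_pow t, ht0]
  simp only [one_pow, one_mul, abs_le]
  refine ⟨⟨?_, ?_⟩, ⟨?_, ?_⟩, ⟨?_, ?_⟩⟩ <;> linarith
end

section
/- The function w is continuously differentiable on the open unit ball B⁴ (ContDiffOn ℝ 1 w B⁴, with fderiv ℝ w 0 = 0), and there is a constant C such that ‖fderiv ℝ w x‖ ≤ C and ‖iteratedFDeriv ℝ 2 w x‖ ≤ C for all x with 0 < ‖x‖ < 1. -/
open Metric

/-- `w(x) = ‖x‖² sin(φ(‖x‖))`; since `φ 0 = 0` this gives `w 0 = 0` as well. -/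
noncomputable def w (x : EuclideanSpace ℝ (Fin 4)) : ℝ := ‖x‖ ^ 2 * Real.sin (φ ‖x‖)

open Topology

theorem hasFDerivAt_comp_norm_sq {E : Type*} [NormedAddCommGroup E] [InnerProductSpace ℝ E]
    {g : ℝ → ℝ} {g' : ℝ} {x : E} (hg : HasDerivAt g g' (‖x‖ ^ 2)) :
    HasFDerivAt (fun y : E => g (‖y‖ ^ 2)) ((2 * g') • innerSL ℝ x) x := by
  have h := hg.comp_hasFDerivAt x (hasStrictFDerivAt_norm_sq x).hasFDerivAt
  refine h.congr_fderiv ?_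
  ext y
  simp
  ring

theorem norm_fderiv_smul_innerSL_le {E : Type*} [NormedAddCommGroup E] [InnerProductSpace ℝ E]
    {c : ℝ → ℝ} {c' : ℝ} {x : E} (hc : HasDerivAt c c' (‖x‖ ^ 2)) :
    DifferentiableAt ℝ (fun y : E => (2 * c (‖y‖ ^ 2)) • innerSL ℝ y) x ∧
    ‖fderiv ℝ (fun y : E => (2 * c (‖y‖ ^ 2)) • innerSL ℝ y) x‖ ≤
      2 * |c (‖x‖ ^ 2)| + 4 * |‖x‖ ^ 2 * c'| := by
  have h1 : HasFDerivAt (fun y : E => 2 * c (‖y‖ ^ 2)) ((2 * (2 * c')) • innerSL ℝ x) x :=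
    hasFDerivAt_comp_norm_sq (hc.const_mul 2)
  have h : HasFDerivAt (fun y : E => (2 * c (‖y‖ ^ 2)) • innerSL ℝ y) _ x :=
    h1.smul (innerSL ℝ : E →L[ℝ] E →L[ℝ] ℝ).hasFDerivAt
  refine ⟨h.differentiableAt, ?_⟩
  rw [h.fderiv]
  refine ContinuousLinearMap.opNorm_le_bound _ (by positivity) fun v => ?_
  change ‖(2 * c (‖x‖ ^ 2)) • innerSL ℝ v + (2 * (2 * c') * inner ℝ x v) • innerSL ℝ x‖ ≤ _
  refine (norm_add_le _ _).trans ?_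
  simp only [norm_smul, innerSL_apply_norm, Real.norm_eq_abs, abs_mul, abs_two,
    abs_of_nonneg (sq_nonneg ‖x‖)]
  calc 2 * |c (‖x‖ ^ 2)| * ‖v‖ + 2 * (2 * |c'|) * |inner ℝ x v| * ‖x‖
      ≤ 2 * |c (‖x‖ ^ 2)| * ‖v‖ + 2 * (2 * |c'|) * (‖x‖ * ‖v‖) * ‖x‖ := by
        gcongr
        exact abs_real_inner_le_norm x v
    _ = (2 * |c (‖x‖ ^ 2)| + 4 * (‖x‖ ^ 2 * |c'|)) * ‖v‖ := by ring

/-- `e - (log s) / 2`, that is `e - log t` in the variable `s = t²`. -/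
noncomputable def innerLog (s : ℝ) : ℝ := Real.exp 1 - Real.log s / 2

/-- `s ψ'(s)` for `ψ s = log (log (innerLog s))`. -/
noncomputable def logSlope (s : ℝ) : ℝ := -1 / (2 * (innerLog s * Real.log (innerLog s)))

/-- The radial profile of `w` in the variable `s = ‖x‖²`. -/
noncomputable def profile (s : ℝ) : ℝ := s * Real.sin (Real.log (Real.log (innerLog s)))

/-- The derivative of `profile` on `(0, 1)`. -/
noncomputable def profileDeriv (s : ℝ) : ℝ :=
  Real.sin (Real.log (Real.log (innerLog s))) +
    logSlope s * Real.cos (Real.log (Real.log (innerLog s)))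

theorem w_eq_profile (x : EuclideanSpace ℝ (Fin 4)) : w x = profile (‖x‖ ^ 2) := by
  simp [w, profile, φ, innerLog, Real.log_pow]

theorem exp_one_le_innerLog {s : ℝ} (h0 : 0 < s) (h1 : s < 1) : Real.exp 1 ≤ innerLog s := by
  have := Real.log_neg h0 h1
  unfold innerLog
  linarith

theorem one_le_innerLog {s : ℝ} (h0 : 0 < s) (h1 : s < 1) : 1 ≤ innerLog s :=
  (Real.one_le_exp zero_le_one).trans (exp_one_le_innerLog h0 h1)

theorem one_le_log_innerLog {s : ℝ} (h0 : 0 < s) (h1 : s < 1) : 1 ≤ Real.log (innerLog s) :=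
  (Real.le_log_iff_exp_le (by linarith [one_le_innerLog h0 h1])).2 (exp_one_le_innerLog h0 h1)

theorem hasDerivAt_innerLog {s : ℝ} (h0 : 0 < s) : HasDerivAt innerLog (-(s⁻¹ / 2)) s :=
  ((Real.hasDerivAt_log h0.ne').div_const 2).const_sub _

theorem hasDerivAt_log_log_innerLog {s : ℝ} (h0 : 0 < s) (h1 : s < 1) :
    HasDerivAt (fun s => Real.log (Real.log (innerLog s))) (logSlope s / s) s := by
  have hL := one_le_innerLog h0 h1
  have hM := one_le_log_innerLog h0 h1
  refine (((hasDerivAt_innerLog h0).log (by positivity)).log (by positivity)).congr_deriv ?_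
  unfold logSlope
  field_simp

theorem hasDerivAt_logSlope {s : ℝ} (h0 : 0 < s) (h1 : s < 1) :
    HasDerivAt logSlope (-(logSlope s ^ 2 * (Real.log (innerLog s) + 1)) / s) s := by
  have hL := one_le_innerLog h0 h1
  have hM := one_le_log_innerLog h0 h1
  have hL' := hasDerivAt_innerLog h0
  have h := (hasDerivAt_const s (-1 : ℝ)).div
    ((hL'.mul (hL'.log (by positivity))).const_mul 2) (by simp only [Pi.mul_apply]; positivity)
  refine h.congr_deriv ?_
  simp only [logSlope, Pi.mul_apply]
  field_simp
  ring

theorem hasDerivAt_profile {s : ℝ} (h0 : 0 < s) (h1 : s < 1) :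
    HasDerivAt profile (profileDeriv s) s := by
  refine ((hasDerivAt_id s).mul (hasDerivAt_log_log_innerLog h0 h1).sin).congr_deriv ?_
  simp only [profileDeriv, id]
  field_simp

theorem abs_logSlope_le {s : ℝ} (h0 : 0 < s) (h1 : s < 1) : |logSlope s| ≤ 1 := by
  have hL := one_le_innerLog h0 h1
  have hM := one_le_log_innerLog h0 h1
  rw [logSlope, abs_div, abs_neg, abs_one, abs_of_pos (by positivity)]
  exact div_le_one_of_le₀ (by nlinarith) (by positivity)

theorem abs_logSlope_sq_mul_le {s : ℝ} (h0 : 0 < s) (h1 : s < 1) :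
    |logSlope s ^ 2 * (Real.log (innerLog s) + 1)| ≤ 1 := by
  have hL := one_le_innerLog h0 h1
  have hM := one_le_log_innerLog h0 h1
  rw [abs_of_nonneg (by positivity), logSlope, div_pow, div_mul_eq_mul_div]
  refine div_le_one_of_le₀ ?_ (by positivity)
  have hLM : Real.log (innerLog s) ≤ innerLog s * Real.log (innerLog s) :=
    le_mul_of_one_le_left (by positivity) hL
  nlinarith

theorem abs_add_mul_le_two {a b c : ℝ} (ha : |a| ≤ 1) (hb : |b| ≤ 1) (hc : |c| ≤ 1) :
    |a + b * c| ≤ 2 := by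
  have := abs_add_le a (b * c)
  have := mul_le_one₀ hb (abs_nonneg c) hc
  rw [← abs_mul] at this
  linarith

theorem abs_profileDeriv_le {s : ℝ} (h0 : 0 < s) (h1 : s < 1) : |profileDeriv s| ≤ 2 :=
  abs_add_mul_le_two (Real.abs_sin_le_one _) (abs_logSlope_le h0 h1) (Real.abs_cos_le_one _)

theorem exists_hasDerivAt_profileDeriv {s : ℝ} (h0 : 0 < s) (h1 : s < 1) :
    ∃ d, HasDerivAt profileDeriv d s ∧ |s * d| ≤ 3 := by
  have hψ := hasDerivAt_log_log_innerLog h0 h1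
  refine ⟨_, hψ.sin.add ((hasDerivAt_logSlope h0 h1).mul hψ.cos), ?_⟩
  have ha := abs_logSlope_le h0 h1
  have hb := abs_logSlope_sq_mul_le h0 h1
  set a := logSlope s
  set b := a ^ 2 * (Real.log (innerLog s) + 1)
  have hsin := Real.abs_sin_le_one (Real.log (Real.log (innerLog s)))
  have hcos := Real.abs_cos_le_one (Real.log (Real.log (innerLog s)))
  set S := Real.sin (Real.log (Real.log (innerLog s)))
  set K := Real.cos (Real.log (Real.log (innerLog s)))
  have key : s * (K * (a / s) + (-b / s * K + a * (-S * (a / s)))) =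
      a * K - b * K - a * a * S := by
    field_simp
    ring
  rw [key]
  have h₁ : |a * K| ≤ 1 := by
    rw [abs_mul]; exact mul_le_one₀ ha (abs_nonneg _) hcos
  have h₂ : |b * K| ≤ 1 := by
    rw [abs_mul]; exact mul_le_one₀ hb (abs_nonneg _) hcos
  have h₃ : |a * a * S| ≤ 1 := by
    rw [abs_mul, abs_mul]
    exact mul_le_one₀ (mul_le_one₀ ha (abs_nonneg _) ha) (abs_nonneg _) hsin
  rw [abs_le] at *
  constructor <;> linarith

theorem hasFDerivAt_w {x : EuclideanSpace ℝ (Fin 4)} (h0 : 0 < ‖x‖) (h1 : ‖x‖ < 1) :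
    HasFDerivAt w ((2 * profileDeriv (‖x‖ ^ 2)) • innerSL ℝ x) x := by
  rw [funext w_eq_profile]
  exact hasFDerivAt_comp_norm_sq
    (hasDerivAt_profile (pow_pos h0 2) (pow_lt_one₀ h0.le h1 two_ne_zero))

theorem hasFDerivAt_w_zero : HasFDerivAt w (0 : EuclideanSpace ℝ (Fin 4) →L[ℝ] ℝ)
    (0 : EuclideanSpace ℝ (Fin 4)) := by
  have hO : w =O[𝓝 0] fun x => ‖x - 0‖ ^ 2 := by
    refine Asymptotics.IsBigO.of_bound 1 (Filter.Eventually.of_forall fun x => ?_)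
    rw [w, norm_mul, sub_zero, one_mul]
    exact mul_le_of_le_one_right (norm_nonneg _) (Real.abs_sin_le_one _)
  exact hO.hasFDerivAt one_lt_two

theorem norm_fderiv_w_le {x : EuclideanSpace ℝ (Fin 4)} (h1 : ‖x‖ < 1) :
    ‖fderiv ℝ w x‖ ≤ 4 * ‖x‖ := by
  rcases (norm_nonneg x).eq_or_lt with h0 | h0
  · obtain rfl := norm_eq_zero.1 h0.symm
    simp [hasFDerivAt_w_zero.fderiv]
  · have := abs_profileDeriv_le (pow_pos h0 2) (pow_lt_one₀ h0.le h1 two_ne_zero)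
    rw [(hasFDerivAt_w h0 h1).fderiv, norm_smul, innerSL_apply_norm, Real.norm_eq_abs, abs_mul,
      abs_two]
    gcongr
    linarith

theorem differentiableAt_fderiv_w {x : EuclideanSpace ℝ (Fin 4)} (h0 : 0 < ‖x‖) (h1 : ‖x‖ < 1) :
    DifferentiableAt ℝ (fderiv ℝ w) x ∧ ‖fderiv ℝ (fderiv ℝ w) x‖ ≤ 16 := by
  have hs0 := pow_pos h0 2
  have hs1 := pow_lt_one₀ h0.le h1 two_ne_zero
  obtain ⟨d, hd, hd3⟩ := exists_hasDerivAt_profileDeriv hs0 hs1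
  obtain ⟨hdiff, hle⟩ := norm_fderiv_smul_innerSL_le hd
  have heq : fderiv ℝ w =ᶠ[𝓝 x] fun y => (2 * profileDeriv (‖y‖ ^ 2)) • innerSL ℝ y := by
    filter_upwards [continuous_norm.continuousAt.eventually (lt_mem_nhds h0),
      continuous_norm.continuousAt.eventually (gt_mem_nhds h1)] with y hy0 hy1
    exact (hasFDerivAt_w hy0 hy1).fderiv
  refine ⟨hdiff.congr_of_eventuallyEq heq, ?_⟩
  rw [heq.fderiv_eq]
  linarith [abs_profileDeriv_le hs0 hs1]

theorem continuousAt_fderiv_w {x : EuclideanSpace ℝ (Fin 4)} (h1 : ‖x‖ < 1) :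
    ContinuousAt (fderiv ℝ w) x := by
  rcases (norm_nonneg x).eq_or_lt with h0 | h0
  · obtain rfl := norm_eq_zero.1 h0.symm
    rw [ContinuousAt, hasFDerivAt_w_zero.fderiv]
    refine squeeze_zero_norm' (a := fun x => 4 * ‖x‖) ?_ ?_
    · filter_upwards [continuous_norm.continuousAt.eventually (gt_mem_nhds h1)] with y hy
      exact norm_fderiv_w_le hy
    · exact (by fun_prop : Continuous fun x : EuclideanSpace ℝ (Fin 4) => 4 * ‖x‖).tendsto' _ _
        (by simp)
  · exact (differentiableAt_fderiv_w h0 h1).1.continuousAt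

/-- `w` is `C¹` on the unit ball with `Dw(0) = 0`, and `‖Dw‖` and `‖D²w‖` are bounded on
the punctured unit ball. -/
theorem stmt_10 :
    ContDiffOn ℝ 1 w (ball (0 : EuclideanSpace ℝ (Fin 4)) 1) ∧
    fderiv ℝ w 0 = 0 ∧
    ∃ C : ℝ, ∀ x : EuclideanSpace ℝ (Fin 4), 0 < ‖x‖ → ‖x‖ < 1 →
      ‖fderiv ℝ w x‖ ≤ C ∧ ‖iteratedFDeriv ℝ 2 w x‖ ≤ C := by
  refine ⟨?_, hasFDerivAt_w_zero.fderiv, 16, fun x h0 h1 => ⟨?_, ?_⟩⟩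
  · rw [show (1 : WithTop ℕ∞) = 0 + 1 from rfl, contDiffOn_succ_iff_fderiv_of_isOpen isOpen_ball]
    refine ⟨fun x hx => ?_, by simp, contDiffOn_zero.2 fun x hx =>
      (continuousAt_fderiv_w (mem_ball_zero_iff.1 hx)).continuousWithinAt⟩
    rcases (norm_nonneg x).eq_or_lt with h0 | h0
    · obtain rfl := norm_eq_zero.1 h0.symm
      exact hasFDerivAt_w_zero.differentiableAt.differentiableWithinAt
    · exact (hasFDerivAt_w h0 (mem_ball_zero_iff.1 hx)).differentiableAt.differentiableWithinAt
  · linarith [norm_fderiv_w_le h1]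
  · rw [← norm_iteratedFDeriv_fderiv, norm_iteratedFDeriv_one]
    exact (differentiableAt_fderiv_w h0 h1).2
end
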